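/- (Analogue of Pillai's theorem for continued fractions) Let x ∈ (0,1). If for every k ∈ ℕ and every string s of k positive integers the disjoint block frequency lim_{n→∞} |{i : 0 ≤ i ≤ n/k, T^{ki}x ∈ C_s}|/(n/k) equals γ(C_s), then for every finite string s of positive integers the overlapping (sliding) frequency lim_{n→∞} |{i : 0 ≤ i ≤ n, T^i x ∈ C_s}|/n also equals γ(C_s). -/

import Mathlib

open MeasureTheory Filter

noncomputable def gaussMap (x : ℝ) : ℝ := Int.fract x⁻¹

noncomputable def gaussMeasure : Measure ℝ :=
  (volume.restrict (Set.Ioo (0:ℝ) 1)).withDensity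
    (fun x => ENNReal.ofReal (1 / ((1 + x) * Real.log 2)))

noncomputable def cfDigit (x : ℝ) (i : ℕ) : ℕ := ⌊(gaussMap^[i] x)⁻¹⌋₊

def cylinder (w : List ℕ) : Set ℝ :=
  {x | x ∈ Set.Ioo (0:ℝ) 1 ∧ ∀ i < w.length, cfDigit x i = w.getD i 0}

noncomputable def blockCount (x : ℝ) (m : ℕ) (s : List ℕ) (N : ℕ) : ℕ :=
  Nat.card {i : ℕ // i ≤ N ∧ (gaussMap^[m * i] x) ∈ cylinder s}

def CFNormal (x : ℝ) : Prop :=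
  ∀ s : List ℕ, s ≠ [] → (∀ a ∈ s, 0 < a) →
    Tendsto (fun n : ℕ => (blockCount x 1 s n : ℝ) / n) atTop
      (nhds (gaussMeasure (cylinder s)).toReal)

def cfVal : List ℕ → ℚ
  | [] => 0
  | a :: t => 1 / (a + cfVal t)

def cfQ (a : ℕ → ℕ) : ℕ → ℕ
  | 0 => 0
  | 1 => 1
  | (m+2) => a (m+1) * cfQ a (m+1) + cfQ a m

def cfP (a : ℕ → ℕ) : ℕ → ℕ
  | 0 => 1
  | 1 => 0
  | (m+2) => a (m+1) * cfP a (m+1) + cfP a m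

section LowerDensity

/-- The set of indices satisfying `P` has lower density at least `c`. -/
def LowerDensityGE (P : ℕ → Prop) (c : ℝ) : Prop :=
  ∀ b < c, ∀ᶠ N : ℕ in atTop, b * N ≤ Nat.card {i : ℕ // i < N ∧ P i}

lemma card_lt_eq (P : ℕ → Prop) [DecidablePred P] (N : ℕ) :
    Nat.card {i : ℕ // i < N ∧ P i} = ((Finset.range N).filter P).card := by
  rw [← Nat.card_eq_finsetCard]
  exact Nat.card_congr (Equiv.subtypeEquivRight fun i => by simp)

lemma LowerDensityGE.of_forall_lt {P : ℕ → Prop} {C : ℝ}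
    (h : ∀ c < C, LowerDensityGE P c) : LowerDensityGE P C := by
  intro b hb
  obtain ⟨c, hbc, hc⟩ := exists_between hb
  exact h c hc b hbc

lemma LowerDensityGE.mono {P : ℕ → Prop} {c d : ℝ} (h : LowerDensityGE P d) (hcd : c ≤ d) :
    LowerDensityGE P c :=
  fun b hb => h b (hb.trans_le hcd)

lemma LowerDensityGE.sum {ι : Type*} (F : Finset ι) {P : ι → ℕ → Prop} {Q : ℕ → Prop}
    {c : ι → ℝ} (h : ∀ u ∈ F, LowerDensityGE (P u) (c u))
    (hdis : ∀ u ∈ F, ∀ v ∈ F, ∀ i, P u i → P v i → u = v)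
    (hQ : ∀ u ∈ F, ∀ i, P u i → Q i) : LowerDensityGE Q (∑ u ∈ F, c u) := by
  classical
  intro b hb
  set ε : ℝ := (∑ u ∈ F, c u - b) / (F.card + 1)
  have hcard : (0 : ℝ) < F.card + 1 := by positivity
  have hε0 : 0 < ε := div_pos (by linarith) hcard
  have hεb : b ≤ ∑ u ∈ F, (c u - ε) := by
    have : ε * (F.card + 1) = ∑ u ∈ F, c u - b := div_mul_cancel₀ _ hcard.ne'
    rw [Finset.sum_sub_distrib, Finset.sum_const, nsmul_eq_mul]
    nlinarith
  have hall : ∀ᶠ N : ℕ in atTop, ∀ u ∈ F,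
      (c u - ε) * N ≤ Nat.card {i : ℕ // i < N ∧ P u i} :=
    (Filter.eventually_all_finset F).2 fun u hu => h u hu _ (by linarith)
  filter_upwards [hall] with N hN
  calc b * N ≤ (∑ u ∈ F, (c u - ε)) * N := by gcongr
    _ = ∑ u ∈ F, (c u - ε) * N := Finset.sum_mul ..
    _ ≤ ∑ u ∈ F, (Nat.card {i : ℕ // i < N ∧ P u i} : ℝ) := Finset.sum_le_sum hN
    _ ≤ Nat.card {i : ℕ // i < N ∧ Q i} := by
      simp_rw [card_lt_eq]
      rw [← Nat.cast_sum, ← Finset.card_biUnion]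
      · refine Nat.cast_le.2 (Finset.card_le_card ?_)
        intro i hi
        simp only [Finset.mem_biUnion, Finset.mem_filter] at hi ⊢
        obtain ⟨u, hu, hi, hPi⟩ := hi
        exact ⟨hi, hQ u hu i hPi⟩
      · intro u hu v hv huv
        refine Finset.disjoint_left.2 fun i hi hi' => huv ?_
        exact hdis u hu v hv i (Finset.mem_filter.1 hi).2 (Finset.mem_filter.1 hi').2

lemma sum_card_residue_le (Q : ℕ → Prop) {k R : ℕ} (hR : R ≤ k) (n : ℕ) :
    ∑ r ∈ Finset.range R, Nat.card {j : ℕ // j < n / k ∧ Q (k * j + r)} ≤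
      Nat.card {i : ℕ // i < n ∧ Q i} := by
  classical
  simp_rw [card_lt_eq]
  rw [← Finset.card_sigma]
  refine Finset.card_le_card_of_injOn (fun p => k * p.2 + p.1) ?_ ?_
  · rintro ⟨r, j⟩ h
    simp only [Finset.coe_sigma, Set.mem_sigma_iff, Finset.mem_coe, Finset.mem_filter,
      Finset.mem_range] at h ⊢
    refine ⟨?_, h.2.2⟩
    calc k * j + r < k * (j + 1) := by rw [mul_add]; omega
      _ ≤ k * (n / k) := Nat.mul_le_mul_left _ h.2.1
      _ ≤ n := Nat.mul_div_le n k
  · rintro ⟨r, j⟩ h ⟨r', j'⟩ h' heq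
    simp only [Finset.coe_sigma, Set.mem_sigma_iff, Finset.mem_coe, Finset.mem_filter,
      Finset.mem_range] at h h' heq
    have hr : r < k := h.1.trans_le hR
    have hr' : r' < k := h'.1.trans_le hR
    have h1 : r = r' := by
      have := congrArg (· % k) heq
      simpa [Nat.mul_add_mod, Nat.mod_eq_of_lt hr, Nat.mod_eq_of_lt hr'] using this
    subst h1
    have h2 : j = j' := Nat.eq_of_mul_eq_mul_left (by omega : 0 < k) (by omega)
    rw [h2]

lemma LowerDensityGE.of_residues {Q : ℕ → Prop} {k R : ℕ} (hk : 0 < k) (hR : R ≤ k) {c : ℝ}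
    (h : ∀ r < R, LowerDensityGE (fun j => Q (k * j + r)) c) :
    LowerDensityGE Q (R * c / k) := by
  intro b hb
  have hk' : (0 : ℝ) < k := by exact_mod_cast hk
  rcases le_or_gt b 0 with hb0 | hb0
  · exact Eventually.of_forall fun N =>
      (mul_nonpos_of_nonpos_of_nonneg hb0 N.cast_nonneg).trans (Nat.cast_nonneg _)
  have hR0 : (0 : ℝ) < R := by
    rcases Nat.eq_zero_or_pos R with h0 | h0
    · subst h0; simp at hb; linarith
    · exact_mod_cast h0
  have hbc : b * k / R < c := by
    rw [div_lt_iff₀ hR0]; rw [lt_div_iff₀ hk'] at hb; linarith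
  obtain ⟨b', hb', hb'c⟩ := exists_between hbc
  have hb'0 : 0 < b' := lt_trans (by positivity) hb'
  have hall : ∀ᶠ N : ℕ in atTop, ∀ r ∈ Finset.range R,
      b' * N ≤ Nat.card {j : ℕ // j < N ∧ Q (k * j + r)} :=
    (Filter.eventually_all_finset _).2 fun r hr => h r (Finset.mem_range.1 hr) _ hb'c
  have hlin : ∀ᶠ n : ℕ in atTop, R * b' * k ≤ (R * b' - b * k) * n := by
    have hpos : 0 < R * b' - b * k := by
      rw [div_lt_iff₀ hR0] at hb'; linarith
    exact (tendsto_natCast_atTop_atTop.const_mul_atTop hpos).eventually_ge_atTop _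
  filter_upwards [(Nat.tendsto_div_const_atTop hk.ne').eventually hall, hlin] with n hn hn'
  have hfloor : (n : ℝ) ≤ k * (n / k : ℕ) + k := by
    have := Nat.lt_mul_div_succ n hk
    rw [mul_add] at this
    exact_mod_cast (by omega : n ≤ k * (n / k) + k)
  calc b * n ≤ R * (b' * (n / k : ℕ)) := by
        have h1 := mul_le_mul_of_nonneg_left hfloor (mul_pos hR0 hb'0).le
        refine le_of_mul_le_mul_left ?_ hk'
        linarith
    _ = ∑ r ∈ Finset.range R, b' * (n / k : ℕ) := by simp
    _ ≤ ∑ r ∈ Finset.range R, (Nat.card {j : ℕ // j < n / k ∧ Q (k * j + r)} : ℝ) :=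
        Finset.sum_le_sum hn
    _ ≤ Nat.card {i : ℕ // i < n ∧ Q i} := by
        exact_mod_cast sum_card_residue_le Q hR n

end LowerDensity

section GaussMeasure

lemma measurable_gaussMap : Measurable gaussMap :=
  measurable_fract.comp measurable_inv

lemma gaussMeasure_apply {A : Set ℝ} (hA : MeasurableSet A) :
    gaussMeasure A = ∫⁻ y in A ∩ Set.Ioo 0 1, ENNReal.ofReal (1 / ((1 + y) * Real.log 2)) := by
  rw [gaussMeasure, withDensity_apply _ hA, Measure.restrict_restrict hA]

instance : IsProbabilityMeasure gaussMeasure := by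
  refine ⟨?_⟩
  have hlog : 0 < Real.log 2 := Real.log_pos one_lt_two
  have hderiv : ∀ y ∈ Set.uIcc (0 : ℝ) 1,
      HasDerivAt (fun y => Real.log (1 + y) / Real.log 2) (1 / ((1 + y) * Real.log 2)) y := by
    intro y hy
    rw [Set.uIcc_of_le zero_le_one] at hy
    have h := (((hasDerivAt_id y).const_add 1).log
      (by simp only [id]; linarith [hy.1])).div_const (Real.log 2)
    simpa only [id, div_div] using h
  have hcont : ContinuousOn (fun y : ℝ => 1 / ((1 + y) * Real.log 2)) (Set.uIcc 0 1) := by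
    refine ContinuousOn.div (by fun_prop) (by fun_prop) fun y hy => ?_
    rw [Set.uIcc_of_le zero_le_one] at hy
    exact (mul_pos (by linarith [hy.1]) hlog).ne'
  have hii := hcont.intervalIntegrable (μ := volume)
  rw [gaussMeasure_apply MeasurableSet.univ, Set.univ_inter, restrict_Ioo_eq_restrict_Ioc,
    ← ofReal_integral_eq_lintegral_ofReal hii.1,
    ← intervalIntegral.integral_of_le zero_le_one,
    intervalIntegral.integral_eq_sub_of_hasDerivAt hderiv hii]
  · norm_num [hlog.ne']
  · filter_upwards [ae_restrict_mem measurableSet_Ioc] with y hy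
    have := hy.1
    simp only [Pi.zero_apply]
    positivity

lemma hasSum_inv_mul_succ {y : ℝ} (hy : 0 < y) :
    HasSum (fun n : ℕ => 1 / (((n : ℝ) + y) * (n + y + 1))) (1 / y) := by
  rw [hasSum_iff_tendsto_nat_of_nonneg fun n => by positivity]
  have hsum : ∀ N : ℕ, ∑ n ∈ Finset.range N, 1 / (((n : ℝ) + y) * (n + y + 1)) =
      1 / y - 1 / (N + y) := by
    intro N
    have := Finset.sum_range_sub' (fun n : ℕ => 1 / ((n : ℝ) + y)) N
    simp only [Nat.cast_zero, zero_add] at this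
    rw [← this]
    refine Finset.sum_congr rfl fun n _ => ?_
    have h1 : (n : ℝ) + y ≠ 0 := by positivity
    have h2 : (n : ℝ) + y + 1 ≠ 0 := by positivity
    have h3 : (n : ℝ) + 1 + y ≠ 0 := by positivity
    push_cast
    field_simp
    ring
  simp_rw [hsum]
  have : Tendsto (fun N : ℕ => 1 / ((N : ℝ) + y)) atTop (nhds 0) :=
    Tendsto.const_div_atTop
      (tendsto_atTop_add_const_right _ _ tendsto_natCast_atTop_atTop) 1
  simpa using this.const_sub (1 / y)

lemma floor_natCast_add {n : ℕ} {y : ℝ} (hy : y ∈ Set.Ioo (0 : ℝ) 1) :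
    ⌊(n : ℝ) + 1 + y⌋ = (n : ℤ) + 1 := by
  rw [Int.floor_eq_iff]
  push_cast
  constructor <;> linarith [hy.1, hy.2]

lemma gaussMap_inv_natCast_add {n : ℕ} {y : ℝ} (hy : y ∈ Set.Ioo (0 : ℝ) 1) :
    gaussMap ((n : ℝ) + 1 + y)⁻¹ = y := by
  rw [gaussMap, inv_inv, ← Int.self_sub_floor, floor_natCast_add hy]
  push_cast
  ring

lemma gaussMeasure_le_preimage {A : Set ℝ} (hA : MeasurableSet A) :
    gaussMeasure A ≤ gaussMeasure (gaussMap ⁻¹' A) := by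
  have hlog : 0 < Real.log 2 := Real.log_pos one_lt_two
  set B : Set ℝ := A ∩ Set.Ioo 0 1
  have hBm : MeasurableSet B := hA.inter measurableSet_Ioo
  let f : ℕ → ℝ → ℝ := fun n y => ((n : ℝ) + 1 + y)⁻¹
  have hinj : ∀ n, Set.InjOn (f n) B := by
    intro n y hy z hz h
    have := inv_injective h
    linarith
  have hfm : ∀ n, MeasurableSet (f n '' B) := fun n =>
    hBm.image_of_measurable_injOn (by fun_prop) (hinj n)
  have hderiv : ∀ n, ∀ y ∈ B,
      HasDerivWithinAt (f n) (-1 / ((n : ℝ) + 1 + y) ^ 2) B y := by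
    intro n y hy
    have hpos : (0 : ℝ) < n + 1 + y := by have := hy.2.1; positivity
    exact (((hasDerivAt_id y).const_add ((n : ℝ) + 1)).inv hpos.ne').hasDerivWithinAt
  have hsub : ∀ n, f n '' B ⊆ Set.Ioo 0 1 := by
    rintro n _ ⟨y, hy, rfl⟩
    have hy0 := hy.2.1
    exact ⟨by positivity, inv_lt_one_of_one_lt₀ (by have := n.cast_nonneg (α := ℝ); linarith)⟩
  have hdis : Pairwise (Function.onFun Disjoint fun n => f n '' B) := by
    intro n m hnm
    refine Set.disjoint_left.2 ?_
    rintro _ ⟨y, hy, rfl⟩ ⟨z, hz, h⟩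
    have h1 := congrArg Int.floor (inv_injective h)
    rw [floor_natCast_add hy.2, floor_natCast_add hz.2] at h1
    omega
  have himg : ∀ n, gaussMeasure (f n '' B) = ∫⁻ y in B,
      ENNReal.ofReal (1 / (((n : ℝ) + (1 + y)) * (n + (1 + y) + 1)) / Real.log 2) := by
    intro n
    rw [gaussMeasure_apply (hfm n), Set.inter_eq_self_of_subset_left (hsub n),
      lintegral_image_eq_lintegral_abs_deriv_mul hBm (hderiv n) (hinj n)]
    refine setLIntegral_congr_fun hBm fun y hy => ?_
    have hy0 := hy.2.1
    have hpos : (0 : ℝ) < n + 1 + y := by positivity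
    simp only [f]
    rw [← ENNReal.ofReal_mul (abs_nonneg _), abs_div, abs_neg, abs_one,
      abs_of_pos (by positivity : (0 : ℝ) < (n + 1 + y) ^ 2)]
    congr 1
    field_simp
    ring
  calc gaussMeasure A = ∫⁻ y in B, ENNReal.ofReal (1 / ((1 + y) * Real.log 2)) :=
        gaussMeasure_apply hA
    _ = ∫⁻ y in B, ∑' n : ℕ,
          ENNReal.ofReal (1 / (((n : ℝ) + (1 + y)) * (n + (1 + y) + 1)) / Real.log 2) := by
        refine setLIntegral_congr_fun hBm fun y hy => ?_
        have hy0 := hy.2.1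
        have hs := (hasSum_inv_mul_succ (by linarith : 0 < 1 + y)).div_const (Real.log 2)
        rw [← ENNReal.ofReal_tsum_of_nonneg (fun n => by positivity) hs.summable, hs.tsum_eq,
          div_div]
    _ = ∑' n : ℕ, gaussMeasure (f n '' B) := by
        rw [lintegral_tsum fun n => by fun_prop]
        exact tsum_congr fun n => (himg n).symm
    _ = gaussMeasure (⋃ n, f n '' B) := (measure_iUnion hdis hfm).symm
    _ ≤ gaussMeasure (gaussMap ⁻¹' A) := by
        refine measure_mono (Set.iUnion_subset ?_)
        rintro n _ ⟨y, hy, rfl⟩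
        rw [Set.mem_preimage, gaussMap_inv_natCast_add hy.2]
        exact hy.1

lemma gaussMeasure_le_preimage_iterate {A : Set ℝ} (hA : MeasurableSet A) (r : ℕ) :
    gaussMeasure A ≤ gaussMeasure (gaussMap^[r] ⁻¹' A) := by
  induction r with
  | zero => simp
  | succ r ih =>
    rw [Function.iterate_succ, Set.preimage_comp]
    exact ih.trans (gaussMeasure_le_preimage (measurable_gaussMap.iterate r hA))

lemma ae_gaussMeasure_mem :
    ∀ᵐ y ∂gaussMeasure, y ∈ Set.Ioo (0 : ℝ) 1 ∧ Irrational y := by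
  refine (withDensity_absolutelyContinuous _ _).ae_le ?_
  filter_upwards [ae_restrict_mem measurableSet_Ioo,
    ae_restrict_of_ae ((Set.countable_range ((↑) : ℚ → ℝ)).ae_notMem volume)] with y h1 h2
  exact ⟨h1, h2⟩

end GaussMeasure

section Cylinder

lemma measurable_cfDigit (i : ℕ) : Measurable fun y => cfDigit y i :=
  Nat.measurable_floor.comp (measurable_inv.comp (measurable_gaussMap.iterate i))

lemma measurableSet_cylinder (w : List ℕ) : MeasurableSet (cylinder w) := by
  have : cylinder w = Set.Ioo 0 1 ∩ ⋂ i, ⋂ _ : i < w.length,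
      (fun y => cfDigit y i) ⁻¹' {w.getD i 0} := by
    ext y; simp [_root_.cylinder]
  rw [this]
  exact measurableSet_Ioo.inter <| MeasurableSet.iInter fun i => MeasurableSet.iInter fun _ =>
    measurable_cfDigit i (measurableSet_singleton _)

lemma cylinder_inj {u v : List ℕ} (h : u.length = v.length) {y : ℝ} (hu : y ∈ cylinder u)
    (hv : y ∈ cylinder v) : u = v := by
  refine List.ext_getElem h fun i h1 h2 => ?_
  have := (hu.2 i h1).symm.trans (hv.2 i h2)
  rwa [List.getD_eq_getElem _ _ h1, List.getD_eq_getElem _ _ h2] at this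

lemma gaussMap_iterate_mem {y : ℝ} (hy : y ∈ Set.Ioo (0 : ℝ) 1 ∧ Irrational y) (i : ℕ) :
    gaussMap^[i] y ∈ Set.Ioo (0 : ℝ) 1 ∧ Irrational (gaussMap^[i] y) := by
  induction i with
  | zero => exact hy
  | succ i ih =>
    rw [Function.iterate_succ_apply']
    have hirr : Irrational (gaussMap (gaussMap^[i] y)) := by
      rw [gaussMap, ← Int.self_sub_floor]
      exact (irrational_inv_iff.2 ih.2).sub_intCast _
    exact ⟨⟨(Int.fract_nonneg _).lt_of_ne hirr.ne_zero.symm, Int.fract_lt_one _⟩, hirr⟩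

lemma exists_mem_cylinder {y : ℝ} (hy : y ∈ Set.Ioo (0 : ℝ) 1 ∧ Irrational y) (k : ℕ) :
    ∃ u : List ℕ, u.length = k ∧ (∀ a ∈ u, 0 < a) ∧ y ∈ cylinder u := by
  refine ⟨(List.range k).map (cfDigit y), by simp, ?_, hy.1, fun i hi => ?_⟩
  · simp only [List.mem_map, forall_exists_index, and_imp]
    rintro _ i _ rfl
    have := (gaussMap_iterate_mem hy i).1
    exact Nat.floor_pos.2 (one_lt_inv₀ this.1 |>.2 this.2).le
  · rw [List.getD_eq_getElem _ _ hi]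
    simp

lemma gaussMap_iterate_mem_cylinder_iff {u s : List ℕ} (hs : s ≠ []) (hpos : ∀ a ∈ s, 0 < a)
    {r : ℕ} (hr : r + s.length ≤ u.length) {y : ℝ} (hy : y ∈ cylinder u) :
    gaussMap^[r] y ∈ cylinder s ↔ ∀ i < s.length, u.getD (r + i) 0 = s.getD i 0 := by
  have hdigit : ∀ i, cfDigit (gaussMap^[r] y) i = cfDigit y (r + i) := fun i => by
    rw [cfDigit, cfDigit, ← Function.iterate_add_apply, add_comm]
  have hlen : 0 < s.length := List.length_pos_iff.2 hs
  constructor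
  · intro h i hi
    rw [← h.2 i hi, hdigit, hy.2 _ (by omega)]
  · intro h
    refine ⟨?_, fun i hi => by rw [hdigit, hy.2 _ (by omega), h i hi]⟩
    have hd : 0 < cfDigit y r := by
      have := h 0 hlen
      rw [add_zero] at this
      rw [hy.2 r (by omega), this, List.getD_eq_getElem _ _ hlen]
      exact hpos _ (List.getElem_mem _)
    have h0 : 0 < gaussMap^[r] y :=
      inv_pos.1 (lt_of_lt_of_le one_pos (Nat.floor_pos.1 hd))
    refine ⟨h0, ?_⟩
    cases r with
    | zero => exact hy.1.2
    | succ r =>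
      rw [Function.iterate_succ_apply']
      exact Int.fract_lt_one _

/-- If a sequence visits every length-`k` cylinder with lower density at least the Gauss measure
of the cylinder, then it has at least the expected lower density in any set containing every
length-`k` cylinder that meets `B`. -/
lemma lowerDensityGE_of_cylinder {z : ℕ → ℝ} {k : ℕ}
    (h : ∀ u : List ℕ, u.length = k → (∀ a ∈ u, 0 < a) →
      LowerDensityGE (fun i => z i ∈ cylinder u) (gaussMeasure (cylinder u)).toReal)
    {B Q : Set ℝ}
    (hBQ : ∀ u : List ℕ, u.length = k → (cylinder u ∩ B).Nonempty → cylinder u ⊆ Q) :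
    LowerDensityGE (fun i => z i ∈ Q) (gaussMeasure B).toReal := by
  let U : Set (List ℕ) := {u | u.length = k ∧ (∀ a ∈ u, 0 < a) ∧ cylinder u ⊆ Q}
  have hle : gaussMeasure B ≤ ∑' u : U, gaussMeasure (cylinder u) := by
    refine le_trans (measure_mono_ae ?_) (measure_iUnion_le fun u : U => cylinder u)
    filter_upwards [ae_gaussMeasure_mem] with y hy hyB
    obtain ⟨u, hlen, hpos, hyu⟩ := exists_mem_cylinder hy k
    exact Set.mem_iUnion.2 ⟨⟨u, hlen, hpos, hBQ u hlen ⟨y, hyu, hyB⟩⟩, hyu⟩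
  refine .of_forall_lt fun c hc => ?_
  rcases lt_or_ge c 0 with h0 | h0
  · exact fun b hb => Eventually.of_forall fun N =>
      (mul_nonpos_of_nonpos_of_nonneg (hb.trans h0).le N.cast_nonneg).trans (Nat.cast_nonneg _)
  have hc' : ENNReal.ofReal c < ∑' u : U, gaussMeasure (cylinder u) :=
    ((ENNReal.ofReal_lt_iff_lt_toReal h0 (measure_ne_top _ _)).2 hc).trans_le hle
  rw [ENNReal.tsum_eq_iSup_sum, lt_iSup_iff] at hc'
  obtain ⟨F, hF⟩ := hc'
  have hcF : c ≤ ∑ u ∈ F, (gaussMeasure (cylinder u)).toReal := by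
    rw [← ENNReal.toReal_sum fun u _ => measure_ne_top _ _]
    exact (ENNReal.ofReal_le_iff_le_toReal
      (ENNReal.sum_ne_top.2 fun u _ => measure_ne_top _ _)).1 hF.le
  refine (LowerDensityGE.sum F (fun u _ => h u u.2.1 u.2.2.1) ?_ ?_).mono hcF
  · exact fun u _ v _ i hu hv => Subtype.ext (cylinder_inj (u.2.1.trans v.2.1.symm) hu hv)
  · exact fun u _ i hu => u.2.2.2 hu

end Cylinder

lemma blockCount_le (x : ℝ) (m : ℕ) (s : List ℕ) (N : ℕ) :
    blockCount x m s N ≤ Nat.card {i : ℕ // i < N ∧ gaussMap^[m * i] x ∈ cylinder s} + 1 := by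
  classical
  have : blockCount x m s N =
      Nat.card {i : ℕ // i < N + 1 ∧ gaussMap^[m * i] x ∈ cylinder s} :=
    Nat.card_congr (Equiv.subtypeEquivRight fun i => by rw [Nat.lt_succ_iff])
  rw [this, card_lt_eq, card_lt_eq, Finset.range_add_one, Finset.filter_insert]
  split_ifs
  · exact Finset.card_insert_le _ _
  · exact Nat.le_succ _

lemma lowerDensityGE_of_tendsto_blockCount {x : ℝ} {s : List ℕ} {c : ℝ} (hs : s ≠ [])
    (h : Tendsto (fun n : ℕ => (blockCount x s.length s (n / s.length) : ℝ) /
      ((n : ℝ) / s.length)) atTop (nhds c)) :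
    LowerDensityGE (fun i => gaussMap^[s.length * i] x ∈ cylinder s) c := by
  intro b hb
  have hlen : 0 < s.length := List.length_pos_iff.2 hs
  obtain ⟨b', hbb', hb'⟩ := exists_between hb
  have h1 := ((tendsto_id.const_mul_atTop' hlen).eventually (h.eventually_const_lt hb'))
  have h2 : ∀ᶠ N : ℕ in atTop, 1 ≤ (b' - b) * N :=
    (tendsto_natCast_atTop_atTop.const_mul_atTop (sub_pos.2 hbb')).eventually_ge_atTop _
  filter_upwards [h1, h2, eventually_gt_atTop 0] with N hN hN' hN0
  have hN0' : (0 : ℝ) < N := by exact_mod_cast hN0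
  have hlen' : (0 : ℝ) < s.length := by exact_mod_cast hlen
  simp only [id, Nat.mul_div_cancel_left _ hlen, Nat.cast_mul] at hN
  rw [mul_div_cancel_left₀ _ hlen'.ne', lt_div_iff₀ hN0'] at hN
  have h3 : (blockCount x s.length s N : ℝ) ≤
      Nat.card {i : ℕ // i < N ∧ gaussMap^[s.length * i] x ∈ cylinder s} + 1 := by
    exact_mod_cast blockCount_le x s.length s N
  linarith

lemma tendsto_blockCount_of_lowerDensityGE {x : ℝ} {s : List ℕ} {c : ℝ}
    (h : LowerDensityGE (fun i => gaussMap^[i] x ∈ cylinder s) c)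
    (h' : LowerDensityGE (fun i => gaussMap^[i] x ∈ (cylinder s)ᶜ) (1 - c)) :
    Tendsto (fun n : ℕ => (blockCount x 1 s n : ℝ) / n) atTop (nhds c) := by
  classical
  rw [tendsto_order]
  constructor
  · intro b hb
    obtain ⟨b', hbb', hb'⟩ := exists_between hb
    filter_upwards [h b' hb', eventually_gt_atTop 0] with n hn hn0
    have hn0' : (0 : ℝ) < n := by exact_mod_cast hn0
    rw [lt_div_iff₀ hn0']
    refine ((mul_lt_mul_of_pos_right hbb' hn0').trans_le hn).trans_le ?_
    have : Finite {i : ℕ // i ≤ n ∧ gaussMap^[1 * i] x ∈ cylinder s} :=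
      ((Set.finite_le_nat n).subset fun i hi => hi.1).to_subtype
    refine Nat.cast_le.2 (Nat.card_le_card_of_injective
      (fun i => ⟨i.1, i.2.1.le, by rw [one_mul]; exact i.2.2⟩) fun i j hij => ?_)
    exact Subtype.ext (Subtype.mk.inj hij)
  · intro b hb
    obtain ⟨b', hb', hbb'⟩ := exists_between hb
    have hlin : ∀ᶠ n : ℕ in atTop, 1 < (b - b') * n :=
      (tendsto_natCast_atTop_atTop.const_mul_atTop (sub_pos.2 hbb')).eventually_gt_atTop _
    filter_upwards [h' (1 - b') (by linarith), hlin, eventually_gt_atTop 0] with n hn hn1 hn0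
    have hn0' : (0 : ℝ) < n := by exact_mod_cast hn0
    rw [div_lt_iff₀ hn0']
    have h1 := blockCount_le x 1 s n
    have h2 := Finset.card_filter_add_card_filter_not (s := Finset.range n)
      (fun i => gaussMap^[i] x ∈ cylinder s)
    simp only [one_mul, card_lt_eq] at h1
    simp only [Set.mem_compl_iff, card_lt_eq] at hn
    rw [Finset.card_range] at h2
    have h1' : (blockCount x 1 s n : ℝ) ≤
      ((Finset.range n).filter fun i => gaussMap^[i] x ∈ cylinder s).card + 1 := by
      exact_mod_cast h1
    have h2' := congrArg (Nat.cast (R := ℝ)) h2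
    push_cast at h2'
    linarith

theorem pillai_analogue (x : ℝ) (hx : x ∈ Set.Ioo (0:ℝ) 1)
    (hdisj : ∀ s : List ℕ, s ≠ [] → (∀ a ∈ s, 0 < a) →
      Tendsto (fun n : ℕ => (blockCount x s.length s (n / s.length) : ℝ) /
          ((n : ℝ) / s.length)) atTop (nhds (gaussMeasure (cylinder s)).toReal)) :
    ∀ s : List ℕ, s ≠ [] → (∀ a ∈ s, 0 < a) →
      Tendsto (fun n : ℕ => (blockCount x 1 s n : ℝ) / n) atTop
        (nhds (gaussMeasure (cylinder s)).toReal) := by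
  have hlower : ∀ s : List ℕ, s ≠ [] → (∀ a ∈ s, 0 < a) →
      LowerDensityGE (fun i => gaussMap^[i] x ∈ cylinder s)
        (gaussMeasure (cylinder s)).toReal := by
    intro s hs hpos
    set c := (gaussMeasure (cylinder s)).toReal
    -- Positions that do not straddle two blocks of length `s.length + K`.
    have hK : ∀ K : ℕ, LowerDensityGE (fun i => gaussMap^[i] x ∈ cylinder s)
        (((K + 1 : ℕ) : ℝ) * c / (s.length + K : ℕ)) := by
      intro K
      have hlen : 0 < s.length := List.length_pos_iff.2 hs
      refine .of_residues (by omega) (by omega) fun r hr => ?_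
      have hr' : r + s.length ≤ s.length + K := by omega
      have := lowerDensityGE_of_cylinder (z := fun j => gaussMap^[(s.length + K) * j] x)
        (k := s.length + K) (B := gaussMap^[r] ⁻¹' cylinder s)
        (Q := gaussMap^[r] ⁻¹' cylinder s) ?_ ?_
      · simp only [Set.mem_preimage, ← Function.iterate_add_apply] at this
        simp_rw [add_comm r] at this
        exact this.mono (ENNReal.toReal_mono (measure_ne_top _ _)
          (gaussMeasure_le_preimage_iterate (measurableSet_cylinder s) r))
      · intro u hu hupos
        have hune : u ≠ [] := List.length_pos_iff.1 (by omega)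
        rw [← hu]
        exact lowerDensityGE_of_tendsto_blockCount hune (hdisj u hune hupos)
      · rintro u hu ⟨y, hyu, hyB⟩ w hw
        exact (gaussMap_iterate_mem_cylinder_iff hs hpos (hu ▸ hr') hw).2
          ((gaussMap_iterate_mem_cylinder_iff hs hpos (hu ▸ hr') hyu).1 hyB)
    refine .of_forall_lt fun b hb => ?_
    have hlim : Tendsto (fun K : ℕ => ((K + 1 : ℕ) : ℝ) * c / (s.length + K : ℕ)) atTop
        (nhds c) := by
      have h := (tendsto_add_mul_div_add_mul_atTop_nhds (1 : ℝ) s.length 1 one_ne_zero).mul_const c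
      simp only [one_mul, div_one] at h
      refine h.congr fun K => ?_
      push_cast
      ring
    obtain ⟨K, hbK⟩ := (hlim.eventually_const_lt hb).exists
    exact (hK K).mono hbK.le
  intro s hs hpos
  refine tendsto_blockCount_of_lowerDensityGE (hlower s hs hpos) ?_
  have hcompl : (gaussMeasure (cylinder s)ᶜ).toReal = 1 - (gaussMeasure (cylinder s)).toReal :=
    probReal_compl_eq_one_sub (measurableSet_cylinder s)
  rw [← hcompl]
  refine lowerDensityGE_of_cylinder (k := s.length) (fun u hu hupos => ?_) ?_
  · exact hlower u (List.length_pos_iff.1 (hu ▸ List.length_pos_iff.2 hs)) hupos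
  · rintro u hu ⟨y, hyu, hys⟩ w hwu hws
    exact hys (cylinder_inj hu hwu hws ▸ hyu)
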